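/- Let G be a finite simple graph that is (P3∪P2)-free, W4-free, K4-free and (P2∪K3)-free. If G contains an induced subgraph isomorphic to F1, then χ(G) ≤ 6. -/

import Mathlib

open SimpleGraph

/-- `P3 ∪ P2`: disjoint union of a path on 3 vertices (0-1-2) and an edge (3-4). -/
def P3P2 : SimpleGraph (Fin 5) :=
  SimpleGraph.fromEdgeSet {s(0,1), s(1,2), s(3,4)}

/-- `W4`: wheel on 5 vertices; 4-cycle 0-1-2-3-0 plus hub 4 adjacent to all. -/
def W4 : SimpleGraph (Fin 5) :=
  SimpleGraph.fromEdgeSet {s(0,1), s(1,2), s(2,3), s(3,0), s(4,0), s(4,1), s(4,2), s(4,3)}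

/-- `P2 ∪ K3`: disjoint union of an edge (0-1) and a triangle (2,3,4). -/
def P2K3 : SimpleGraph (Fin 5) :=
  SimpleGraph.fromEdgeSet {s(0,1), s(2,3), s(3,4), s(2,4)}

/-- `F1`: 6-cycle v1 v2 u2 u1 u3 v3 (= 0 1 2 3 4 5) plus edges v2v3 (1-5) and u2u3 (2-4). -/
def F1 : SimpleGraph (Fin 6) :=
  SimpleGraph.fromEdgeSet {s(0,1), s(1,2), s(2,3), s(3,4), s(4,5), s(5,0), s(1,5), s(2,4)}

set_option linter.unusedSimpArgs false

/-- A relation-preserving map is injective as soon as distinct vertices get distinct images. -/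
def mkEmb {V : Type*} {n : ℕ} {H : SimpleGraph (Fin n)} {G : SimpleGraph V} (f : Fin n → V)
    (hi : Function.Injective f) (h : ∀ i j, G.Adj (f i) (f j) ↔ H.Adj i j) : H ↪g G :=
  ⟨⟨f, hi⟩, by intro i j; exact h i j⟩

theorem noP {V : Type*} {G : SimpleGraph V} (hP : IsEmpty (P3P2 ↪g G)) (a b c d e : V)
    (hac : a ≠ c) (h1 : G.Adj a b) (h2 : G.Adj b c) (h3 : G.Adj d e)
    (n1 : ¬ G.Adj a c) (n2 : ¬ G.Adj a d) (n3 : ¬ G.Adj a e) (n4 : ¬ G.Adj b d)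
    (n5 : ¬ G.Adj b e) (n6 : ¬ G.Adj c d) (n7 : ¬ G.Adj c e) : False := by
  have s := fun x y => G.adj_comm x y
  refine hP.elim (mkEmb ![a, b, c, d, e] ?_ ?_)
  · intro i j hij
    have e1 := h1.ne
    have e2 := h2.ne
    have e3 := h3.ne
    have e4 : a ≠ d := by rintro rfl; exact n4 h1.symm
    have e5 : a ≠ e := by rintro rfl; exact n2 h3.symm
    have e6 : b ≠ d := by rintro rfl; exact n2 h1
    have e7 : b ≠ e := by rintro rfl; exact n3 h1
    have e8 : c ≠ d := by rintro rfl; exact n4 h2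
    have e9 : c ≠ e := by rintro rfl; exact n5 h2
    fin_cases i <;> fin_cases j <;> simp_all [eq_comm]
  · intro i j
    fin_cases i <;> fin_cases j <;>
      simp [P3P2, h1, h2, h3, n1, n2, n3, n4, n5, n6, n7, h1.symm, h2.symm, h3.symm,
        s c a, s d a, s e a, s d b, s e b, s d c, s e c]

theorem noT {V : Type*} {G : SimpleGraph V} (hT : IsEmpty (P2K3 ↪g G)) (a b c d e : V)
    (h1 : G.Adj a b) (h2 : G.Adj c d) (h3 : G.Adj d e) (h4 : G.Adj c e)
    (n1 : ¬ G.Adj a c) (n2 : ¬ G.Adj a d) (n3 : ¬ G.Adj a e) (n4 : ¬ G.Adj b c)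
    (n5 : ¬ G.Adj b d) (n6 : ¬ G.Adj b e) : False := by
  have s := fun x y => G.adj_comm x y
  refine hT.elim (mkEmb ![a, b, c, d, e] ?_ ?_)
  · intro i j hij
    have e1 := h1.ne
    have e2 := h2.ne
    have e3 := h3.ne
    have e0 := h4.ne
    have e4 : a ≠ c := by rintro rfl; exact n2 h2
    have e5 : a ≠ d := by rintro rfl; exact n3 h3
    have e6 : a ≠ e := by rintro rfl; exact n1 h4.symm
    have e7 : b ≠ c := by rintro rfl; exact n1 h1
    have e8 : b ≠ d := by rintro rfl; exact n2 h1
    have e9 : b ≠ e := by rintro rfl; exact n3 h1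
    fin_cases i <;> fin_cases j <;> simp_all [eq_comm]
  · intro i j
    fin_cases i <;> fin_cases j <;>
      simp [P2K3, h1, h2, h3, h4, n1, n2, n3, n4, n5, n6, h1.symm, h2.symm, h3.symm, h4.symm,
        s c a, s d a, s e a, s c b, s d b, s e b]

theorem noW {V : Type*} {G : SimpleGraph V} (hW : IsEmpty (W4 ↪g G)) (a b c d e : V)
    (hac : a ≠ c) (hbd : b ≠ d)
    (h1 : G.Adj a b) (h2 : G.Adj b c) (h3 : G.Adj c d) (h4 : G.Adj d a)
    (k1 : G.Adj e a) (k2 : G.Adj e b) (k3 : G.Adj e c) (k4 : G.Adj e d)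
    (n1 : ¬ G.Adj a c) (n2 : ¬ G.Adj b d) : False := by
  have s := fun x y => G.adj_comm x y
  refine hW.elim (mkEmb ![a, b, c, d, e] ?_ ?_)
  · intro i j hij
    have e1 := h1.ne
    have e2 := h2.ne
    have e3 := h3.ne
    have e4 := h4.ne
    have e5 := k1.ne
    have e6 := k2.ne
    have e7 := k3.ne
    have e8 := k4.ne
    fin_cases i <;> fin_cases j <;> simp_all [eq_comm]
  · intro i j
    fin_cases i <;> fin_cases j <;>
      simp [W4, h1, h2, h3, h4, n1, n2, k1, k2, k3, k4, h1.symm, h2.symm, h3.symm, h4.symm,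
        k1.symm, k2.symm, k3.symm, k4.symm, s c a, s d b]

theorem noK {V : Type*} {G : SimpleGraph V} (hK : G.CliqueFree 4) (a b c d : V)
    (h1 : G.Adj a b) (h2 : G.Adj a c) (h3 : G.Adj a d) (h4 : G.Adj b c) (h5 : G.Adj b d)
    (h6 : G.Adj c d) : False := by
  classical
  refine hK {a, b, c, d} ?_
  have l1 := h1.ne
  have l2 := h2.ne
  have l3 := h3.ne
  have l4 := h4.ne
  have l5 := h5.ne
  have l6 := h6.ne
  refine ⟨?_, by simp_all⟩
  simp [isClique_iff, Set.pairwise_insert, h1, h2, h3, h4, h5, h6, h1.symm, h2.symm, h3.symm,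
    h4.symm, h5.symm, h6.symm]

/-- The closed set attached to an edge `ab`: its ends and all vertices anticomplete to it. -/
def far {V : Type*} (G : SimpleGraph V) (a b x : V) : Prop :=
  x = a ∨ x = b ∨ (¬ G.Adj x a ∧ ¬ G.Adj x b)

theorem far_unique {V : Type*} {G : SimpleGraph V} (hP : IsEmpty (P3P2 ↪g G))
    (hT : IsEmpty (P2K3 ↪g G)) {a b : V} (hab : G.Adj a b) {x y z : V}
    (hx : far G a b x) (hy : far G a b y) (hz : far G a b z)
    (hxy : G.Adj x y) (hxz : G.Adj x z) : y = z := by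
  have s := fun x y => G.adj_comm x y
  by_contra hne
  by_cases hyz : G.Adj y z
  · have t := noT hT a b x y z hab hxy hyz hxz
    have l1 := hxy.ne
    have l2 := hxz.ne
    unfold far at hx hy hz
    grind
  · have t := noP hP y x z a b hne hxy.symm hxz hab hyz
    have l1 := hxy.ne
    have l2 := hxz.ne
    unfold far at hx hy hz
    grind

theorem far_bip {V : Type*} [Fintype V] {G : SimpleGraph V} (hP : IsEmpty (P3P2 ↪g G))
    (hT : IsEmpty (P2K3 ↪g G)) {a b : V} (hab : G.Adj a b) :
    ∃ c : V → Bool, ∀ x y, far G a b x → far G a b y → G.Adj x y → c x ≠ c y := by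
  classical
  let r := Fintype.equivFin V
  have key : ∀ x y, far G a b x → far G a b y → G.Adj x y → r y < r x →
      (∃ z, far G a b z ∧ G.Adj x z ∧ r z < r x) ∧
        ¬ (∃ z, far G a b z ∧ G.Adj y z ∧ r z < r y) := by
    intro x y hx hy hxy hlt
    refine ⟨⟨y, hy, hxy, hlt⟩, ?_⟩
    rintro ⟨z, hz, hyz, hzy⟩
    have := far_unique hP hT hab hy hx hz hxy.symm hyz
    subst this
    exact absurd (hlt.trans hzy) (lt_irrefl _)
  refine ⟨fun x => decide (∃ z, far G a b z ∧ G.Adj x z ∧ r z < r x), ?_⟩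
  intro x y hx hy hxy
  rcases lt_trichotomy (r x) (r y) with h | h | h
  · have := key y x hy hx hxy.symm h
    simp only [ne_eq, decide_eq_decide]
    intro hiff
    exact this.2 (hiff.2 this.1)
  · exact absurd (r.injective h) hxy.ne
  · have := key x y hx hy hxy h
    simp only [ne_eq, decide_eq_decide]
    intro hiff
    exact this.2 (hiff.1 this.1)

theorem stmt13 {V : Type*} [Fintype V] (G : SimpleGraph V)
    (hP : IsEmpty (P3P2 ↪g G)) (hW : IsEmpty (W4 ↪g G)) (hK4 : G.CliqueFree 4)
    (hP2K3 : IsEmpty (P2K3 ↪g G)) (hQ : Nonempty (F1 ↪g G)) :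
    G.chromaticNumber ≤ 6 := by
  classical
  obtain ⟨φ⟩ := hQ
  have adj : ∀ i j, G.Adj (φ i) (φ j) ↔ F1.Adj i j := fun i j => φ.map_rel_iff
  obtain ⟨a0, h0⟩ : ∃ a, a = φ 0 := ⟨_, rfl⟩
  obtain ⟨a1, h1⟩ : ∃ a, a = φ 1 := ⟨_, rfl⟩
  obtain ⟨a2, h2⟩ : ∃ a, a = φ 2 := ⟨_, rfl⟩
  obtain ⟨a3, h3⟩ : ∃ a, a = φ 3 := ⟨_, rfl⟩
  obtain ⟨a4, h4⟩ : ∃ a, a = φ 4 := ⟨_, rfl⟩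
  obtain ⟨a5, h5⟩ : ∃ a, a = φ 5 := ⟨_, rfl⟩
  have e01 : G.Adj a0 a1 := by rw [h0, h1, adj]; simp [F1]
  have e05 : G.Adj a0 a5 := by rw [h0, h5, adj]; simp [F1]
  have e12 : G.Adj a1 a2 := by rw [h1, h2, adj]; simp [F1]
  have e15 : G.Adj a1 a5 := by rw [h1, h5, adj]; simp [F1]
  have e23 : G.Adj a2 a3 := by rw [h2, h3, adj]; simp [F1]
  have e24 : G.Adj a2 a4 := by rw [h2, h4, adj]; simp [F1]
  have e34 : G.Adj a3 a4 := by rw [h3, h4, adj]; simp [F1]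
  have e45 : G.Adj a4 a5 := by rw [h4, h5, adj]; simp [F1]
  have n02 : ¬ G.Adj a0 a2 := by rw [h0, h2, adj]; simp [F1]
  have n03 : ¬ G.Adj a0 a3 := by rw [h0, h3, adj]; simp [F1]
  have n04 : ¬ G.Adj a0 a4 := by rw [h0, h4, adj]; simp [F1]
  have n13 : ¬ G.Adj a1 a3 := by rw [h1, h3, adj]; simp [F1]
  have n14 : ¬ G.Adj a1 a4 := by rw [h1, h4, adj]; simp [F1]
  have n25 : ¬ G.Adj a2 a5 := by rw [h2, h5, adj]; simp [F1]
  have n35 : ¬ G.Adj a3 a5 := by rw [h3, h5, adj]; simp [F1]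
  clear h0 h1 h2 h3 h4 h5 adj φ
  have s := fun x y => G.adj_comm x y
  -- vertices outside the two `far` sets are not on the `F1`
  have hne : ∀ x, ¬ far G a2 a3 x → ¬ far G a0 a1 x →
      (x ≠ a0 ∧ x ≠ a1 ∧ x ≠ a2 ∧ x ≠ a3 ∧ x ≠ a4 ∧ x ≠ a5) ∧
        (G.Adj x a2 ∨ G.Adj x a3) ∧ (G.Adj x a0 ∨ G.Adj x a1) := by
    intro x hx hy
    unfold far at hx hy
    grind
  -- vertices of class A see exactly two vertices of the triangle `a2 a3 a4`
  have hA : ∀ x, ¬ far G a2 a3 x → ¬ far G a0 a1 x → (G.Adj x a2 ∨ G.Adj x a4) →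
      (G.Adj x a2 ∧ G.Adj x a3 ∧ ¬ G.Adj x a4) ∨ (G.Adj x a2 ∧ ¬ G.Adj x a3 ∧ G.Adj x a4) ∨
        (¬ G.Adj x a2 ∧ G.Adj x a3 ∧ G.Adj x a4) := by
    intro x hx hy hz
    obtain ⟨⟨d0, d1, d2, d3, d4, d5⟩, p, q⟩ := hne x hx hy
    have c1 := noK hK4 a2 a3 a4 x
    have c2 := noK hK4 a0 a1 a5 x
    have c3 := noP hP a0 a1 x a3 a4
    have c4 := noP hP a1 a0 x a3 a4
    have c5 := noP hP a2 a3 x a0 a5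
    have c6 := noP hP a3 a2 x a0 a5
    have c7 := noW hW a1 a2 a4 a5 x
    have c8 := noT hP2K3 a0 a5 a2 a3 x
    have c9 := noT hP2K3 a3 a4 a0 a1 x
    clear hx hy hne hP hW hP2K3 hK4
    simp only [s a0 x, s a1 x, s a2 x, s a3 x, s a4 x, s a5 x, s a4 a2, s a5 a4, s a4 a3, s a5 a1,
      s a1 a0, s a2 a0, s a3 a0, s a4 a0, s a5 a0, s a2 a1, s a3 a1, s a4 a1, s a3 a2, s a5 a2,
      s a5 a3, e01, e05, e12, e15, e23, e24, e34, e45, n02, n03, n04, n13, n14, n25, n35] at *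
    grind
  have hAA : ∀ x y, ¬ far G a2 a3 x → ¬ far G a0 a1 x → (G.Adj x a2 ∨ G.Adj x a4) →
      ¬ far G a2 a3 y → ¬ far G a0 a1 y → (G.Adj y a2 ∨ G.Adj y a4) → ¬ G.Adj x y := by
    intro x y hx1 hx2 hx3 hy1 hy2 hy3 hxy
    have tx := hA x hx1 hx2 hx3
    have ty := hA y hy1 hy2 hy3
    obtain ⟨⟨d0, d1, d2, d3, d4, d5⟩, -⟩ := hne x hx1 hx2
    obtain ⟨⟨f0, f1, f2, f3, f4, f5⟩, -⟩ := hne y hy1 hy2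
    rcases tx with ⟨x2, x3, x4⟩ | ⟨x2, x3, x4⟩ | ⟨x2, x3, x4⟩ <;>
    rcases ty with ⟨y2, y3, y4⟩ | ⟨y2, y3, y4⟩ | ⟨y2, y3, y4⟩
    · exact noK hK4 a2 a3 x y e23 x2.symm y2.symm x3.symm y3.symm hxy
    · exact noW hW a3 a4 y x a2 f3.symm d4.symm e34 y4.symm hxy.symm x3 e23 e24 y2.symm x2.symm
        (by rwa [s]) (by rwa [s])
    · exact noW hW a2 a4 y x a3 f2.symm d4.symm e24 y4.symm hxy.symm x2 e23.symm e34 y3.symm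
        x3.symm (by rwa [s]) (by rwa [s])
    · exact noW hW a3 a4 x y a2 d3.symm f4.symm e34 x4.symm hxy y3 e23 e24 x2.symm y2.symm
        (by rwa [s]) (by rwa [s])
    · exact noK hK4 a2 a4 x y e24 x2.symm y2.symm x4.symm y4.symm hxy
    · exact noW hW a2 a3 y x a4 f2.symm d3.symm e23 y3.symm hxy.symm x2 e24.symm e34.symm y4.symm
        x4.symm (by rwa [s]) (by rwa [s])
    · exact noW hW a2 a4 x y a3 d2.symm f4.symm e24 x4.symm hxy y2 e23.symm e34 x3.symm
        y3.symm (by rwa [s]) (by rwa [s])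
    · exact noW hW a2 a3 x y a4 d2.symm f3.symm e23 x3.symm hxy y2 e24.symm e34.symm x4.symm
        y4.symm (by rwa [s]) (by rwa [s])
    · exact noK hK4 a3 a4 x y e34 x3.symm y3.symm x4.symm y4.symm hxy
  have hBB : ∀ x y, ¬ far G a2 a3 x → ¬ far G a0 a1 x → ¬ (G.Adj x a2 ∨ G.Adj x a4) →
      ¬ far G a2 a3 y → ¬ far G a0 a1 y → ¬ (G.Adj y a2 ∨ G.Adj y a4) → ¬ G.Adj x y := by
    intro x y hx1 hx2 hx3 hy1 hy2 hy3 hxy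
    obtain ⟨⟨d0, d1, d2, d3, d4, d5⟩, p, q⟩ := hne x hx1 hx2
    obtain ⟨⟨f0, f1, f2, f3, f4, f5⟩, pp, qq⟩ := hne y hy1 hy2
    have c1 := noT hP2K3 a2 a4 a0 x y
    have c2 := noP hP a0 x y a2 a4
    have c3 := noP hP a0 y x a2 a4
    have c4 := noP hP a2 a3 x a0 a5
    have c5 := noP hP a2 a3 y a0 a5
    have c6 := noK hK4 a1 a5 x y
    clear hx1 hx2 hy1 hy2 hne hA hAA hP hW hP2K3 hK4
    simp only [s a0 x, s a1 x, s a2 x, s a3 x, s a4 x, s a5 x, s a0 y, s a1 y, s a2 y, s a3 y,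
      s a4 y, s a5 y, s y x, s a4 a2, s a5 a4, s a4 a3, s a5 a1,
      s a1 a0, s a2 a0, s a3 a0, s a4 a0, s a5 a0, s a2 a1, s a3 a1, s a4 a1, s a3 a2, s a5 a2,
      s a5 a3, e01, e05, e12, e15, e23, e24, e34, e45, n02, n03, n04, n13, n14, n25, n35, hxy] at *
    grind
  obtain ⟨c, hc⟩ := far_bip hP hP2K3 e23
  obtain ⟨cc, hd⟩ := far_bip hP hP2K3 e01
  have hcol : G.Colorable 6 := by
    refine ⟨Coloring.mk (fun x => if far G a2 a3 x then (if c x then 0 else 1)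
      else if far G a0 a1 x then (if cc x then 2 else 3)
      else if G.Adj x a2 ∨ G.Adj x a4 then (4 : Fin 6) else 5) ?_⟩
    intro x y hxy
    have k1 := hc x y
    have k2 := hd x y
    have k3 := hAA x y
    have k4 := hBB x y
    clear hc hd hAA hBB hA hne s
    split_ifs <;> simp_all
  exact_mod_cast hcol.chromaticNumber_le
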